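/- Let γ > 1, λ ≥ 0, μ ≥ 0, and let (u,v) be a C¹ solution of the damped compressible Euler system on [0,T]×ℝ with u everywhere positive. Let x₋ be a minus characteristic curve (x₋'(t) = −c(u(t,x₋(t)))) and set q = A(t)√(c(u)) s_x. Then for every t ∈ [0,T], ∫₀ᵗ q(τ, x₋(τ)) (1+τ)^{−μ} dτ = ∫₀ᵗ (A(τ)/(1+τ)^μ) ( μ/(1+τ) − λ/(2(1+τ)^μ) ) θ_γ(u(τ, x₋(τ))) dτ + A(t)(1+t)^{−μ} θ_γ(u(t, x₋(t))) − θ_γ(u(0, x₋(0))). -/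

import Mathlib

noncomputable section
open Real Set

/-- Partial derivative with respect to time of a function of `(t, x)`. -/
def pdt (f : ℝ → ℝ → ℝ) (t x : ℝ) : ℝ := deriv (fun τ => f τ x) t

/-- Partial derivative with respect to space of a function of `(t, x)`. -/
def pdx (f : ℝ → ℝ → ℝ) (t x : ℝ) : ℝ := deriv (fun ξ => f t ξ) x

/-- The strip `[0,T] × ℝ`. -/
def strip (T : ℝ) : Set (ℝ × ℝ) := Set.Icc 0 T ×ˢ (Set.univ : Set ℝ)

/-- The half-space `[0,∞) × ℝ`. -/
def stripInf : Set (ℝ × ℝ) := Set.Ici (0 : ℝ) ×ˢ (Set.univ : Set ℝ)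

/-- The pressure `p(u) = u^(-γ)/γ`. -/
def pres (γ u : ℝ) : ℝ := u ^ (-γ) / γ

/-- The sound speed `c(u) = u^(-(γ+1)/2)`. -/
def cspeed (γ u : ℝ) : ℝ := u ^ (-(γ + 1) / 2)

/-- The first Riemann invariant `r = v - (2/(γ-1)) u^(-(γ-1)/2) + 2/(γ-1)`. -/
def rInv (γ u v : ℝ) : ℝ := v - (2 / (γ - 1)) * u ^ (-(γ - 1) / 2) + 2 / (γ - 1)

/-- The second Riemann invariant `s = v + (2/(γ-1)) u^(-(γ-1)/2) - 2/(γ-1)`. -/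
def sInv (γ u v : ℝ) : ℝ := v + (2 / (γ - 1)) * u ^ (-(γ - 1) / 2) - 2 / (γ - 1)

/-- `(u,v)` solves the damped compressible Euler system on the set `S`. -/
def IsEulerOn (γ lam μ : ℝ) (u v : ℝ → ℝ → ℝ) (S : Set (ℝ × ℝ)) : Prop :=
  ∀ p ∈ S, pdt u p.1 p.2 - pdx v p.1 p.2 = 0 ∧
    pdt v p.1 p.2 + pdx (fun t x => pres γ (u t x)) p.1 p.2
      = -(lam / (1 + p.1) ^ μ) * v p.1 p.2

/-- `f` is `C¹` on `S ⊆ ℝ × ℝ`. -/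
def IsC1On (f : ℝ → ℝ → ℝ) (S : Set (ℝ × ℝ)) : Prop :=
  ContDiffOn ℝ 1 (fun p : ℝ × ℝ => f p.1 p.2) S

/-- `f` is `C²` on `S ⊆ ℝ × ℝ`. -/
def IsC2On (f : ℝ → ℝ → ℝ) (S : Set (ℝ × ℝ)) : Prop :=
  ContDiffOn ℝ 2 (fun p : ℝ × ℝ => f p.1 p.2) S

/-- `f` is `C¹_b` on `S ⊆ ℝ × ℝ`: `C¹` with `f` and its first partials bounded. -/
def IsC1bOn (f : ℝ → ℝ → ℝ) (S : Set (ℝ × ℝ)) : Prop :=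
  IsC1On f S ∧ ∃ M : ℝ, ∀ p ∈ S, |f p.1 p.2| + |pdt f p.1 p.2| + |pdx f p.1 p.2| ≤ M

/-- `f : ℝ → ℝ` is `C¹_b`. -/
def IsC1b (f : ℝ → ℝ) : Prop :=
  ContDiff ℝ 1 f ∧ ∃ M : ℝ, ∀ x, |f x| + |deriv f x| ≤ M

/-- The damping coefficient `λ/(2(1+t)^μ)`. -/
def damp (lam μ t : ℝ) : ℝ := lam / (2 * (1 + t) ^ μ)

/-- `A(t) = exp(∫₀ᵗ λ/(2(1+τ)^μ) dτ)`. -/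
def Afun (lam μ t : ℝ) : ℝ := Real.exp (∫ τ in (0 : ℝ)..t, damp lam μ τ)

/-- `θ_γ(u)`. -/
def theta (γ u : ℝ) : ℝ :=
  if γ = 3 then Real.log u else (4 / (3 - γ)) * (u ^ ((3 - γ) / 4) - 1)

/-- The square root of the sound speed is a power of `u`. -/
lemma sqrt_cspeed (γ : ℝ) {w : ℝ} (hw : 0 < w) :
    Real.sqrt (cspeed γ w) = w ^ (-(γ + 1) / 4) := by
  rw [cspeed, Real.sqrt_eq_rpow, ← Real.rpow_mul hw.le]
  congr 1
  ring

/-- `θ_γ' = √c` on the positive half-line. -/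
lemma hasDerivAt_theta (γ : ℝ) {w : ℝ} (hw : 0 < w) :
    HasDerivAt (theta γ) (Real.sqrt (cspeed γ w)) w := by
  rw [sqrt_cspeed γ hw]
  by_cases h : γ = 3
  · have hfun : theta γ = Real.log := by
      funext y
      simp [theta, h]
    have hexp : -(γ + 1) / 4 = (-1 : ℝ) := by
      rw [h]
      norm_num
    rw [hfun, hexp, Real.rpow_neg_one]
    exact Real.hasDerivAt_log hw.ne'
  · have hfun : theta γ = fun y => (4 / (3 - γ)) * (y ^ ((3 - γ) / 4) - 1) := by
      funext y
      simp [theta, h]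
    have h3 : 3 - γ ≠ 0 := fun h' => h (by linarith)
    rw [hfun]
    refine (((Real.hasDerivAt_rpow_const (p := (3 - γ) / 4) (Or.inl hw.ne')).sub_const 1).const_mul
      (4 / (3 - γ))).congr_deriv ?_
    have hexp : (3 - γ) / 4 - 1 = -(γ + 1) / 4 := by ring
    rw [hexp]
    field_simp

lemma continuousOn_damp (lam μ : ℝ) : ContinuousOn (damp lam μ) (Set.Ioi (-1)) := by
  intro τ hτ
  have h1 : 0 < 1 + τ := by linarith [Set.mem_Ioi.1 hτ]
  have hpow : 0 < (1 + τ) ^ μ := Real.rpow_pos_of_pos h1 μ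
  have hc : ContinuousAt (fun y : ℝ => (1 + y) ^ μ) τ :=
    (continuousAt_const.add continuousAt_id).rpow_const (Or.inl h1.ne')
  exact (continuousAt_const.div (continuousAt_const.mul hc)
    (mul_ne_zero two_ne_zero hpow.ne')).continuousWithinAt

lemma hasDerivAt_Afun (lam μ : ℝ) {t : ℝ} (ht : 0 ≤ t) :
    HasDerivAt (Afun lam μ) (Afun lam μ t * damp lam μ t) t := by
  have hmem : t ∈ Set.Ioi (-1 : ℝ) := by
    rw [Set.mem_Ioi]
    linarith
  have hint : IntervalIntegrable (damp lam μ) MeasureTheory.volume 0 t := by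
    refine ((continuousOn_damp lam μ).mono fun τ hτ => ?_).intervalIntegrable
    rw [Set.uIcc_of_le ht] at hτ
    rw [Set.mem_Ioi]
    linarith [hτ.1]
  exact (intervalIntegral.integral_hasDerivAt_right hint
    ((continuousOn_damp lam μ).stronglyMeasurableAtFilter isOpen_Ioi t hmem)
    ((continuousOn_damp lam μ).continuousAt (isOpen_Ioi.mem_nhds hmem))).exp

lemma strip_mem_nhds {T t : ℝ} (ht : t ∈ Set.Ioo 0 T) (x : ℝ) : strip T ∈ nhds (t, x) :=
  prod_mem_nhds (Icc_mem_nhds ht.1 ht.2) Filter.univ_mem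

/-- At interior points of the strip, the derivative within the strip is the full derivative. -/
lemma IsC1On.hasFDerivAt {f : ℝ → ℝ → ℝ} {T t : ℝ} (hf : IsC1On f (strip T))
    (ht : t ∈ Set.Ioo 0 T) (x : ℝ) :
    HasFDerivAt (fun p : ℝ × ℝ => f p.1 p.2)
      (fderivWithin ℝ (fun p : ℝ × ℝ => f p.1 p.2) (strip T) (t, x)) (t, x) := by
  have hn := strip_mem_nhds ht x
  rw [fderivWithin_of_mem_nhds hn]
  exact ((hf.differentiableOn one_ne_zero).differentiableAt hn).hasFDerivAt

lemma IsC1On.hasDerivAt_space {f : ℝ → ℝ → ℝ} {T t : ℝ} (hf : IsC1On f (strip T))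
    (ht : t ∈ Set.Ioo 0 T) (x : ℝ) :
    HasDerivAt (fun ξ => f t ξ)
      (fderivWithin ℝ (fun p : ℝ × ℝ => f p.1 p.2) (strip T) (t, x) (0, 1)) x :=
  (hf.hasFDerivAt ht x).comp_hasDerivAt x ((hasDerivAt_const x t).prodMk (hasDerivAt_id x))

lemma IsC1On.hasDerivAt_time {f : ℝ → ℝ → ℝ} {T t : ℝ} (hf : IsC1On f (strip T))
    (ht : t ∈ Set.Ioo 0 T) (x : ℝ) :
    HasDerivAt (fun τ => f τ x)
      (fderivWithin ℝ (fun p : ℝ × ℝ => f p.1 p.2) (strip T) (t, x) (1, 0)) t :=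
  HasFDerivAt.comp_hasDerivAt (f := fun τ : ℝ => (τ, x)) t (hf.hasFDerivAt ht x)
    ((hasDerivAt_id t).prodMk (hasDerivAt_const t x))

/-- Chain rule along a curve. -/
lemma IsC1On.hasDerivAt_curve {f : ℝ → ℝ → ℝ} {T t m : ℝ} {y : ℝ → ℝ}
    (hf : IsC1On f (strip T)) (ht : t ∈ Set.Ioo 0 T) (hy : HasDerivAt y m t) :
    HasDerivAt (fun τ => f τ (y τ)) (pdt f t (y t) + m * pdx f t (y t)) t := by
  refine ((hf.hasFDerivAt ht (y t)).comp_hasDerivAt t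
    ((hasDerivAt_id t).prodMk hy)).congr_deriv ?_
  have hsplit : ((1 : ℝ), m) = (1, 0) + m • ((0 : ℝ), (1 : ℝ)) := by simp
  rw [hsplit, map_add, map_smul, smul_eq_mul, pdt, pdx, (hf.hasDerivAt_time ht _).deriv,
    (hf.hasDerivAt_space ht _).deriv]

/-- `s_x = v_x - c u_x` in the interior of the strip. -/
lemma pdx_sInv {γ T t : ℝ} {u v : ℝ → ℝ → ℝ} (hγ : 1 < γ) (hu : IsC1On u (strip T))
    (hv : IsC1On v (strip T)) (ht : t ∈ Set.Ioo 0 T) (x : ℝ) (hpos : 0 < u t x) :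
    pdx (fun t x => sInv γ (u t x) (v t x)) t x
      = pdx v t x - cspeed γ (u t x) * pdx u t x := by
  have hdu := hu.hasDerivAt_space ht x
  have hdv := hv.hasDerivAt_space ht x
  have hpdu : pdx u t x = _ := hdu.deriv
  have hpdv : pdx v t x = _ := hdv.deriv
  have hs := ((hdv.add ((hdu.rpow_const (p := -(γ - 1) / 2) (Or.inl hpos.ne')).const_mul
    (2 / (γ - 1)))).sub_const (2 / (γ - 1))).deriv
  refine Eq.trans hs ?_
  rw [hpdu, hpdv, cspeed]
  have h1 : γ - 1 ≠ 0 := by linarith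
  have hexp : -(γ - 1) / 2 - 1 = -(γ + 1) / 2 := by ring
  rw [hexp]
  field_simp
  ring

/-- Along a minus characteristic, the derivative of `θ_γ(u)` is `√(c(u)) s_x`. -/
lemma hasDerivAt_theta_characteristic {γ lam μ T t : ℝ} {u v : ℝ → ℝ → ℝ} {xm : ℝ → ℝ}
    (hγ : 1 < γ) (hu : IsC1On u (strip T)) (hv : IsC1On v (strip T))
    (hpos : ∀ p ∈ strip T, 0 < u p.1 p.2) (hsol : IsEulerOn γ lam μ u v (strip T))
    (ht : t ∈ Set.Ioo 0 T) (hxm : HasDerivAt xm (-(cspeed γ (u t (xm t)))) t) :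
    HasDerivAt (fun τ => theta γ (u τ (xm τ)))
      (Real.sqrt (cspeed γ (u t (xm t))) *
        pdx (fun t x => sInv γ (u t x) (v t x)) t (xm t)) t := by
  have hmem : (t, xm t) ∈ strip T := mem_of_mem_nhds (strip_mem_nhds ht _)
  have hp : 0 < u t (xm t) := hpos _ hmem
  have hcons : pdt u t (xm t) - pdx v t (xm t) = 0 := (hsol _ hmem).1
  refine ((hasDerivAt_theta γ hp).comp t (hu.hasDerivAt_curve ht hxm)).congr_deriv ?_
  rw [pdx_sInv hγ hu hv ht _ hp, sub_eq_zero.1 hcons]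
  ring

lemma IsC1On.continuousOn_fderivWithin_curve {f : ℝ → ℝ → ℝ} {T : ℝ} {y : ℝ → ℝ}
    (hT : 0 < T) (hf : IsC1On f (strip T)) (hy : ContinuousOn y (Set.Icc 0 T)) :
    ContinuousOn (fun τ =>
      fderivWithin ℝ (fun p : ℝ × ℝ => f p.1 p.2) (strip T) (τ, y τ) (0, 1)) (Set.Icc 0 T) :=
  ((ContDiffOn.continuousOn_fderivWithin hf ((uniqueDiffOn_Icc hT).prod uniqueDiffOn_univ)
    le_rfl).comp (continuousOn_id.prodMk hy) fun _ hτ => ⟨hτ, Set.mem_univ _⟩).clm_apply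
    continuousOn_const

/-- Integral identity for `q = A(t)√(c(u)) s_x` along a minus
characteristic curve. -/
theorem q_integral_identity_along_characteristic
    (γ lam μ T : ℝ) (u v : ℝ → ℝ → ℝ) (xm : ℝ → ℝ)
    (hγ : 1 < γ) (hlam : 0 ≤ lam) (hμ : 0 ≤ μ) (hT : 0 < T)
    (hu : IsC1On u (strip T)) (hv : IsC1On v (strip T))
    (hpos : ∀ p ∈ strip T, 0 < u p.1 p.2)
    (hsol : IsEulerOn γ lam μ u v (strip T))
    (hxm : ∀ t ∈ Set.Icc (0:ℝ) T,
      HasDerivAt xm (-(cspeed γ (u t (xm t)))) t) :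
    ∀ t ∈ Set.Icc (0:ℝ) T,
      (∫ τ in (0:ℝ)..t,
          (Afun lam μ τ * Real.sqrt (cspeed γ (u τ (xm τ))) *
            pdx (fun t x => sInv γ (u t x) (v t x)) τ (xm τ)) * (1 + τ) ^ (-μ))
        = (∫ τ in (0:ℝ)..t,
            (Afun lam μ τ / (1 + τ) ^ μ) *
              (μ / (1 + τ) - lam / (2 * (1 + τ) ^ μ)) * theta γ (u τ (xm τ)))
          + (Afun lam μ t * (1 + t) ^ (-μ) * theta γ (u t (xm t))
              - theta γ (u 0 (xm 0))) := by
  intro t ht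
  have hsub : Set.Icc 0 t ⊆ Set.Icc 0 T := Set.Icc_subset_Icc_right ht.2
  have hup : ∀ τ ∈ Set.Icc 0 T, 0 < u τ (xm τ) := fun τ hτ =>
    hpos (τ, xm τ) ⟨hτ, Set.mem_univ _⟩
  have hone : ∀ τ ∈ Set.Icc 0 T, 0 < 1 + τ := fun τ hτ => by linarith [hτ.1]
  have hxc : ContinuousOn xm (Set.Icc 0 T) := fun τ hτ =>
    (hxm τ hτ).continuousAt.continuousWithinAt
  have huc : ContinuousOn (fun τ => u τ (xm τ)) (Set.Icc 0 T) :=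
    (ContDiffOn.continuousOn hu).comp (continuousOn_id.prodMk hxc)
      fun τ hτ => ⟨hτ, Set.mem_univ _⟩
  have hcc : ContinuousOn (fun τ => cspeed γ (u τ (xm τ))) (Set.Icc 0 T) :=
    huc.rpow_const fun τ hτ => Or.inl (hup τ hτ).ne'
  have hAc : ContinuousOn (Afun lam μ) (Set.Icc 0 T) := fun τ hτ =>
    (hasDerivAt_Afun lam μ hτ.1).continuousAt.continuousWithinAt
  have hθc : ContinuousOn (fun τ => theta γ (u τ (xm τ))) (Set.Icc 0 T) := fun τ hτ =>
    ContinuousAt.comp_continuousWithinAt (f := fun τ => u τ (xm τ))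
      (hasDerivAt_theta γ (hup τ hτ)).continuousAt (huc τ hτ)
  have hlin : ContinuousOn (fun τ : ℝ => 1 + τ) (Set.Icc 0 T) := by fun_prop
  have hpowc : ∀ a : ℝ, ContinuousOn (fun τ : ℝ => (1 + τ) ^ a) (Set.Icc 0 T) := fun a =>
    hlin.rpow_const fun τ hτ => Or.inl (hone τ hτ).ne'
  have hpow0 : ∀ τ ∈ Set.Icc 0 T, (1 + τ) ^ μ ≠ 0 := fun τ hτ =>
    (Real.rpow_pos_of_pos (hone τ hτ) μ).ne'
  have hq : IntervalIntegrable (fun τ =>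
      (Afun lam μ τ * Real.sqrt (cspeed γ (u τ (xm τ))) *
        pdx (fun t x => sInv γ (u t x) (v t x)) τ (xm τ)) * (1 + τ) ^ (-μ))
      MeasureTheory.volume 0 t := by
    have hcont := ((hAc.mul hcc.sqrt).mul ((hv.continuousOn_fderivWithin_curve hT hxc).sub
      (hcc.mul (hu.continuousOn_fderivWithin_curve hT hxc)))).mul (hpowc (-μ))
    refine ((hcont.mono hsub).intervalIntegrable_of_Icc ht.1).congr_ae ?_
    rw [Set.uIoc_of_le ht.1, ← MeasureTheory.restrict_Ioo_eq_restrict_Ioc]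
    filter_upwards [MeasureTheory.ae_restrict_mem measurableSet_Ioo] with τ hτ
    have hτ' : τ ∈ Set.Ioo 0 T := ⟨hτ.1, hτ.2.trans_le ht.2⟩
    have hpdu : pdx u τ (xm τ) = _ := (hu.hasDerivAt_space hτ' (xm τ)).deriv
    have hpdv : pdx v τ (xm τ) = _ := (hv.hasDerivAt_space hτ' (xm τ)).deriv
    rw [pdx_sInv hγ hu hv hτ' _ (hup τ (Set.Ioo_subset_Icc_self hτ')), hpdu, hpdv]
    rfl
  have hR : IntervalIntegrable (fun τ =>
      (Afun lam μ τ / (1 + τ) ^ μ) *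
        (μ / (1 + τ) - lam / (2 * (1 + τ) ^ μ)) * theta γ (u τ (xm τ)))
      MeasureTheory.volume 0 t := by
    refine ContinuousOn.intervalIntegrable_of_Icc ht.1 (ContinuousOn.mono ?_ hsub)
    exact ((hAc.div (hpowc μ) hpow0).mul
      ((continuousOn_const.div hlin fun τ hτ => (hone τ hτ).ne').sub
        (continuousOn_const.div (continuousOn_const.mul (hpowc μ))
          fun τ hτ => mul_ne_zero two_ne_zero (hpow0 τ hτ)))).mul hθc
  have hFTC := intervalIntegral.integral_eq_sub_of_hasDerivAt_of_le ht.1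
    (f := fun τ => Afun lam μ τ * (1 + τ) ^ (-μ) * theta γ (u τ (xm τ)))
    (((hAc.mul (hpowc (-μ))).mul hθc).mono hsub) (fun τ hτ => ?_) (hq.sub hR)
  · rw [intervalIntegral.integral_sub hq hR] at hFTC
    have hA0 : Afun lam μ 0 = 1 := by simp [Afun]
    simp only [hA0, add_zero, Real.one_rpow, one_mul] at hFTC
    linarith
  · have hτ' : τ ∈ Set.Ioo 0 T := ⟨hτ.1, hτ.2.trans_le ht.2⟩
    have hτI := Set.Ioo_subset_Icc_self hτ'
    have h1 := hone τ hτI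
    have hdpow : HasDerivAt (fun y : ℝ => (1 + y) ^ (-μ)) (1 * -μ * (1 + τ) ^ (-μ - 1)) τ :=
      ((hasDerivAt_id τ).const_add 1).rpow_const (Or.inl h1.ne')
    refine (((hasDerivAt_Afun lam μ hτ.1.le).mul hdpow).mul
      (hasDerivAt_theta_characteristic hγ hu hv hpos hsol hτ' (hxm τ hτI))).congr_deriv ?_
    have hne := hpow0 τ hτI
    simp only [Pi.mul_apply, damp, Real.rpow_sub_one h1.ne', Real.rpow_neg h1.le]
    field_simp
    ring
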